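/- Let ℍ denote the quaternions over ℝ (Mathlib's Quaternion ℝ), with conjugation star and norm ‖·‖, and let S⁷ = {(a,b) : ℍ × ℍ | ‖a‖² + ‖b‖² = 1} with the subspace topology. The Cayley–Dickson product (a,b)·(c,d) := (a·c − d·star b, star a·d + c·b) restricts to a continuous multiplication on S⁷ with two-sided unit (1,0); in particular S⁷ admits an H-space structure in the sense of Mathlib (a point e, a continuous multiplication μ with μ(e,e) = e, and homotopies rel e from μ(e,·) and μ(·,e) to the identity). -/

import Mathlib

open Quaternion

theorem norm_sq_cayleyDickson_mul (a b c d : Quaternion ℝ) :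
    ‖a * c - d * star b‖ ^ 2 + ‖star a * d + c * b‖ ^ 2 =
      (‖a‖ ^ 2 + ‖b‖ ^ 2) * (‖c‖ ^ 2 + ‖d‖ ^ 2) := by
  simp only [sq, ← Quaternion.normSq_eq_norm_mul_self, Quaternion.normSq_def', Quaternion.re_mul,
    Quaternion.imI_mul, Quaternion.imJ_mul, Quaternion.imK_mul, Quaternion.re_star,
    Quaternion.imI_star, Quaternion.imJ_star, Quaternion.imK_star, Quaternion.re_sub,
    Quaternion.imI_sub, Quaternion.imJ_sub, Quaternion.imK_sub, Quaternion.re_add,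
    Quaternion.imI_add, Quaternion.imJ_add, Quaternion.imK_add]
  ring

/-- A continuous multiplication with a strict two-sided unit is an H-space structure. -/
theorem nonempty_hSpace_of_unital {X : Type*} [TopologicalSpace X] (e : X) (μ : X × X → X)
    (hμ : Continuous μ) (he : ∀ x, μ (e, x) = x ∧ μ (x, e) = x) : Nonempty (HSpace X) :=
  letI : MulOneClass X :=
    { one := e
      mul := fun x y => μ (x, y)
      one_mul := fun x => (he x).1
      mul_one := fun x => (he x).2 }
  haveI : ContinuousMul X := ⟨hμ⟩
  ⟨IsTopologicalGroup.toHSpace X⟩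

/-- The Cayley–Dickson product `(a,b)·(c,d) := (a·c − d·star b, star a·d + c·b)`
restricts to a continuous multiplication on
`S⁷ = {(a,b) : ℍ × ℍ | ‖a‖² + ‖b‖² = 1}` with two-sided unit `(1,0)`; in
particular `S⁷` admits an H-space structure. -/
theorem sphere_seven_hSpace :
    (∃ (e : {z : Quaternion ℝ × Quaternion ℝ // ‖z.1‖ ^ 2 + ‖z.2‖ ^ 2 = 1})
        (μ : {z : Quaternion ℝ × Quaternion ℝ // ‖z.1‖ ^ 2 + ‖z.2‖ ^ 2 = 1} ×
              {z : Quaternion ℝ × Quaternion ℝ // ‖z.1‖ ^ 2 + ‖z.2‖ ^ 2 = 1} →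
            {z : Quaternion ℝ × Quaternion ℝ // ‖z.1‖ ^ 2 + ‖z.2‖ ^ 2 = 1}),
      (e : Quaternion ℝ × Quaternion ℝ) = (1, 0) ∧
      Continuous μ ∧
      (∀ x y, (μ (x, y) : Quaternion ℝ × Quaternion ℝ) =
        (x.1.1 * y.1.1 - y.1.2 * star x.1.2,
         star x.1.1 * y.1.2 + y.1.1 * x.1.2)) ∧
      (∀ x, μ (e, x) = x ∧ μ (x, e) = x)) ∧
    Nonempty (HSpace
      {z : Quaternion ℝ × Quaternion ℝ // ‖z.1‖ ^ 2 + ‖z.2‖ ^ 2 = 1}) := by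
  refine (fun h => ⟨h, ?_⟩) ⟨⟨(1, 0), by simp⟩,
    fun p => ⟨(p.1.1.1 * p.2.1.1 - p.2.1.2 * star p.1.1.2,
      star p.1.1.1 * p.2.1.2 + p.2.1.1 * p.1.1.2), ?_⟩, rfl, ?_, fun _ _ => rfl, fun x => ?_⟩
  · obtain ⟨e, μ, -, hμ, -, he⟩ := h
    exact nonempty_hSpace_of_unital e μ hμ he
  · rw [norm_sq_cayleyDickson_mul, p.1.2, p.2.2, one_mul]
  · fun_prop
  · constructor <;> ext1 <;> simp
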